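/- Let M be a d-tape automaton on alphabet A = A₁ × ⋯ × A_d, let q and r be states of M, and let Y_q, Y_r ⊆ [0,1]^d be the sets Y_s = {Δ(c) : c ∈ A^ℕ is s-accepted by M}. Then q and r have a common universal prefix (a single finite word x ∈ A^* that is a universal prefix for both q and r) if and only if Y_q ∩ Y_r has nonempty interior in ℝ^d. -/

import Mathlib

/-- `ConcatEq w s` : the infinite concatenation `w 0 ++ w 1 ++ ⋯` equals the
infinite sequence `s`. -/
def ConcatEq {α : Type*} (w : ℕ → List α) (s : ℕ → α) : Prop :=
  ∀ (n : ℕ) (j : Fin (w n).length),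
    s (((Finset.range n).sum fun i => (w i).length) + (j : ℕ)) = (w n).get j

/-- The configuration `c` is `q`-accepted by the `d`-tape automaton with state type `Q`,
tape alphabets `A k` and transition set `T`. -/
def AcceptsD {d : ℕ} {Q : Type*} {A : Fin d → Type*}
    (T : Set (Q × Q × ((k : Fin d) → List (A k)))) (q : Q)
    (c : ℕ → (k : Fin d) → A k) : Prop :=
  ∃ t : ℕ → Q × Q × ((k : Fin d) → List (A k)),
    (∀ n, t n ∈ T) ∧ (t 0).1 = q ∧ (∀ n, (t n).2.1 = (t (n + 1)).1) ∧
    ∀ k : Fin d, ConcatEq (fun n => (t n).2.2 k) (fun i => c i k)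

/-- `Δ_k` of an infinite word: `Σ_{i≥1} δ(u_i)·|A_k|^{-i}`. -/
noncomputable def deltaInf {α : Type*} [Fintype α] (δ : α ≃ Fin (Fintype.card α))
    (s : ℕ → α) : ℝ :=
  ∑' i : ℕ, ((δ (s i) : ℕ) : ℝ) / (Fintype.card α : ℝ) ^ (i + 1)

/-- `Δ(c) ∈ [0,1]^d` of a configuration `c`. -/
noncomputable def DeltaC {d : ℕ} {A : Fin d → Type*} [∀ k, Fintype (A k)]
    (δ : (k : Fin d) → A k ≃ Fin (Fintype.card (A k)))
    (c : ℕ → (k : Fin d) → A k) : EuclideanSpace ℝ (Fin d) :=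
  (WithLp.equiv 2 ((k : Fin d) → ℝ)).symm fun k => deltaInf (δ k) fun i => c i k

/-- `Y_q = { Δ(c) : c is q-accepted }`. -/
noncomputable def Yset {d : ℕ} {Q : Type*} {A : Fin d → Type*} [∀ k, Fintype (A k)]
    (δ : (k : Fin d) → A k ≃ Fin (Fintype.card (A k)))
    (T : Set (Q × Q × ((k : Fin d) → List (A k)))) (q : Q) :
    Set (EuclideanSpace ℝ (Fin d)) :=
  {x | ∃ c : ℕ → (k : Fin d) → A k, AcceptsD T q c ∧ x = DeltaC δ c}

/-- Prepend a finite word to an infinite sequence. -/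
def prependSeq {α : Type*} (x : List α) (y : ℕ → α) : ℕ → α :=
  fun i => if h : i < x.length then x.get ⟨i, h⟩ else y (i - x.length)

open Filter Topology

namespace Real

theorem ofDigits_pos {b : ℕ} {a : ℕ → Fin b} {m : ℕ} (hm : 0 < (a m : ℕ)) :
    0 < ofDigits a := by
  have hb : 0 < b := Fin.pos (a 0)
  refine lt_of_lt_of_le ?_
    (summable_ofDigitsTerm.le_tsum m fun _ _ => ofDigitsTerm_nonneg)
  unfold ofDigitsTerm
  positivity

theorem ofDigits_lt_one {b : ℕ} {a : ℕ → Fin b} {m : ℕ} (hm : (a m : ℕ) + 1 < b) :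
    ofDigits a < 1 := by
  have hb : 1 < b := by omega
  rw [← ofDigits_const_last_eq_one' hb]
  refine Summable.tsum_lt_tsum (i := m) (fun n => ?_) ?_ summable_ofDigitsTerm
    summable_ofDigitsTerm
  · have : (a n : ℕ) ≤ b - 1 := by omega
    simp only [ofDigitsTerm]
    gcongr
  · have : (a m : ℕ) < b - 1 := by omega
    simp only [ofDigitsTerm]
    gcongr

theorem ofDigits_eq_head_add_tail {b : ℕ} (a : ℕ → Fin b) :
    ofDigits a = ((a 0 : ℕ) + ofDigits fun i => a (i + 1)) / b := by
  rw [ofDigits_eq_sum_add_ofDigits a 1]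
  simp [ofDigitsTerm]
  ring

/-- A digit sequence none of whose tails evaluates to `0` or `1` is the only expansion of its
value. -/
theorem eq_of_ofDigits_eq {b : ℕ} {a a' : ℕ → Fin b}
    (h0 : ∀ n, 0 < ofDigits fun i => a (i + n)) (h1 : ∀ n, (ofDigits fun i => a (i + n)) < 1)
    (h : ofDigits a = ofDigits a') : a = a' := by
  have hb : (0 : ℝ) < b := by exact_mod_cast Fin.pos (a 0)
  have step : ∀ n, ((ofDigits fun i => a (i + n)) = ofDigits fun i => a' (i + n)) →
      a n = a' n ∧ ((ofDigits fun i => a (i + (n + 1))) = ofDigits fun i => a' (i + (n + 1))) := by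
    intro n hn
    rw [ofDigits_eq_head_add_tail, ofDigits_eq_head_add_tail fun i => a' (i + n),
      div_left_inj' hb.ne'] at hn
    simp only [zero_add, add_assoc, add_comm 1 n] at hn
    have p0 := h0 (n + 1)
    have p1 := h1 (n + 1)
    have q0 := ofDigits_nonneg fun i => a' (i + (n + 1))
    have q1 := ofDigits_le_one fun i => a' (i + (n + 1))
    have hle : (a n : ℕ) < (a' n : ℕ) + 1 := by
      have : ((a n : ℕ) : ℝ) < (a' n : ℕ) + 1 := by linarith
      exact_mod_cast this
    have hge : (a' n : ℕ) < (a n : ℕ) + 1 := by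
      have : ((a' n : ℕ) : ℝ) < (a n : ℕ) + 1 := by linarith
      exact_mod_cast this
    have heq : a n = a' n := Fin.ext (by omega)
    refine ⟨heq, ?_⟩
    rw [heq] at hn
    exact add_left_cancel hn
  have key : ∀ n, (ofDigits fun i => a (i + n)) = ofDigits fun i => a' (i + n) := by
    intro n
    induction n with
    | zero => simpa using h
    | succ n ih => exact (step n ih).2
  exact funext fun n => (step n (key n)).1

end Real

theorem deltaInf_eq_ofDigits {α : Type*} [Fintype α] (δ : α ≃ Fin (Fintype.card α))
    (s : ℕ → α) : deltaInf δ s = Real.ofDigits fun i => δ (s i) := by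
  simp only [deltaInf, Real.ofDigits, Real.ofDigitsTerm, div_eq_mul_inv]

theorem prependSeq_cons_zero {α : Type*} (a : α) (x : List α) (y : ℕ → α) :
    prependSeq (a :: x) y 0 = a := by
  simp [prependSeq]

theorem prependSeq_cons_succ {α : Type*} (a : α) (x : List α) (y : ℕ → α) (i : ℕ) :
    prependSeq (a :: x) y (i + 1) = prependSeq x y i := by
  simp [prependSeq]

theorem tendsto_of_agree_below {X : Type*} [TopologicalSpace X] {c : ℕ → X} {u : ℕ → ℕ → X}
    (h : ∀ n, ∀ i < n, u n i = c i) : Tendsto u atTop (𝓝 c) := by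
  rw [tendsto_pi_nhds]
  intro i
  refine tendsto_const_nhds.congr' ?_
  filter_upwards [eventually_gt_atTop i] with n hn
  exact (h n i hn).symm

theorem isClosed_setOf_acceptsD {d : ℕ} {Q : Type*} {A : Fin d → Type*}
    [∀ k, TopologicalSpace (A k)] [∀ k, DiscreteTopology (A k)]
    {T : Set (Q × Q × ((k : Fin d) → List (A k)))}
    (hT : T.Finite) (q : Q) : IsClosed {c | AcceptsD T q c} := by
  let _ : TopologicalSpace T := ⊥
  have _ : DiscreteTopology T := ⟨rfl⟩
  have _ : Finite T := hT
  let P : Set ((ℕ → T) × (ℕ → (k : Fin d) → A k)) :=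
    {p | (p.1 0).1.1 = q ∧ (∀ n, (p.1 n).1.2.1 = (p.1 (n + 1)).1.1) ∧
      ∀ (k : Fin d) (n m j : ℕ) (a : A k),
        (((Finset.range n).sum fun i => ((p.1 i).1.2.2 k).length) = m ∧
          ((p.1 n).1.2.2 k)[j]? = some a) → p.2 (m + j) k = a}
  have hP : IsClosed P := by
    have path : ∀ n, Continuous fun p : (ℕ → T) × (ℕ → (k : Fin d) → A k) => p.1 n :=
      fun n => (continuous_apply n).comp continuous_fst
    simp only [P, Set.ofPred_and, Set.ofPred_forall]
    refine IsClosed.inter ?_ (IsClosed.inter ?_ ?_)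
    · exact (isClosed_discrete {t : T | t.1.1 = q}).preimage (path 0)
    · exact isClosed_iInter fun n =>
        (isClosed_discrete {t : T × T | t.1.1.2.1 = t.2.1.1}).preimage
          ((path n).prodMk (path (n + 1)))
    · refine isClosed_iInter fun k => isClosed_iInter fun n => isClosed_iInter fun m =>
        isClosed_iInter fun j => isClosed_iInter fun a => isClosed_imp (IsOpen.inter ?_ ?_) ?_
      · have hsum : Continuous fun p : (ℕ → T) × (ℕ → (k : Fin d) → A k) =>
            (Finset.range n).sum fun i => ((p.1 i).1.2.2 k).length :=
          continuous_finsetSum _ fun i _ =>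
            (continuous_of_discreteTopology (f := fun t : T => (t.1.2.2 k).length)).comp (path i)
        exact (isOpen_discrete {m}).preimage hsum
      · exact (isOpen_discrete {t : T | (t.1.2.2 k)[j]? = some a}).preimage (path n)
      · exact (isClosed_discrete {a}).preimage
          ((continuous_apply k).comp ((continuous_apply (m + j)).comp continuous_snd))
  convert! isClosedMap_snd_of_compactSpace P hP using 1
  ext c
  constructor
  · rintro ⟨t, ht, h0, hs, hc⟩
    refine ⟨(fun n => ⟨t n, ht n⟩, c), ⟨h0, hs, ?_⟩, rfl⟩
    rintro k n m j a ⟨rfl, ha⟩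
    obtain ⟨hj, rfl⟩ := List.getElem?_eq_some_iff.1 ha
    exact hc k n ⟨j, hj⟩
  · rintro ⟨⟨t, c⟩, ⟨h0, hs, hc⟩, rfl⟩
    exact ⟨fun n => (t n).1, fun n => (t n).2, h0, hs,
      fun k n j => hc k n _ j _ ⟨rfl, List.getElem?_eq_getElem j.2⟩⟩

section

variable {d : ℕ} {Q : Type*} {A : Fin d → Type*} [∀ k, Fintype (A k)]

/-- The configuration agreeing with `c` on the first `n` positions, and whose digits alternate
between `0` and `1` on every tape afterwards. -/
def alternateFrom (hA : ∀ k, 1 < Fintype.card (A k))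
    (δ : (k : Fin d) → A k ≃ Fin (Fintype.card (A k)))
    (c : ℕ → (k : Fin d) → A k) (n : ℕ) : ℕ → (k : Fin d) → A k :=
  fun i k => if i < n then c i k else (δ k).symm ⟨i % 2, by have := hA k; omega⟩

theorem deltaC_apply (δ : (k : Fin d) → A k ≃ Fin (Fintype.card (A k)))
    (c : ℕ → (k : Fin d) → A k) (k : Fin d) :
    DeltaC δ c k = deltaInf (δ k) fun i => c i k := rfl

theorem eq_of_deltaC_alternateFrom_eq (hA : ∀ k, 1 < Fintype.card (A k))
    (δ : (k : Fin d) → A k ≃ Fin (Fintype.card (A k)))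
    (c c' : ℕ → (k : Fin d) → A k) (n : ℕ)
    (h : DeltaC δ (alternateFrom hA δ c n) = DeltaC δ c') : alternateFrom hA δ c n = c' := by
  have tape : ∀ k, (fun i => δ k (alternateFrom hA δ c n i k)) = fun i => δ k (c' i k) := by
    intro k
    have digit : ∀ m, n ≤ m → (δ k (alternateFrom hA δ c n m k) : ℕ) = m % 2 := by
      intro m hm
      simp [alternateFrom, hm.not_gt]
    refine Real.eq_of_ofDigits_eq (fun m => ?_) (fun m => ?_) ?_
    · refine Real.ofDigits_pos (m := 2 * n + m + 1) ?_
      rw [digit _ (by omega)]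
      omega
    · refine Real.ofDigits_lt_one (m := 2 * n + m) ?_
      rw [digit _ (by omega)]
      have := hA k
      omega
    · simpa only [deltaC_apply, deltaInf_eq_ofDigits] using congrArg (fun v => v k) h
  funext i k
  exact (δ k).injective (congrFun (tape k) i)

theorem exists_deltaInf_prependSeq (δ : (k : Fin d) → A k ≃ Fin (Fintype.card (A k)))
    (k : Fin d) (x : List ((k : Fin d) → A k)) :
    ∃ p : ℝ, ∀ y : ℕ → (k : Fin d) → A k,
      deltaInf (δ k) (fun i => prependSeq x y i k) =
        p + (deltaInf (δ k) fun i => y i k) / (Fintype.card (A k) : ℝ) ^ x.length := by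
  induction x with
  | nil => exact ⟨0, fun y => by simp [prependSeq]⟩
  | cons a x ih =>
    obtain ⟨p, hp⟩ := ih
    refine ⟨((δ k (a k) : ℕ) + p) / Fintype.card (A k), fun y => ?_⟩
    have hy := hp y
    rw [deltaInf_eq_ofDigits] at hy ⊢
    rw [Real.ofDigits_eq_head_add_tail]
    simp only [prependSeq_cons_zero, prependSeq_cons_succ, hy, List.length_cons, pow_succ]
    ring

section Topology

variable [∀ k, TopologicalSpace (A k)] [∀ k, DiscreteTopology (A k)]

theorem continuous_deltaC (δ : (k : Fin d) → A k ≃ Fin (Fintype.card (A k))) :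
    Continuous (DeltaC δ) := by
  refine (PiLp.continuous_toLp 2 _).comp (continuous_pi fun k => ?_)
  simp only [deltaInf_eq_ofDigits]
  refine Real.continuous_ofDigits.comp (continuous_pi fun i => ?_)
  exact continuous_of_discreteTopology.comp
    ((continuous_apply k).comp (continuous_apply i))

theorem acceptsD_of_deltaC_mem_interior (hA : ∀ k, 1 < Fintype.card (A k))
    (δ : (k : Fin d) → A k ≃ Fin (Fintype.card (A k)))
    {T : Set (Q × Q × ((k : Fin d) → List (A k)))} (hT : T.Finite) {q : Q}
    {c : ℕ → (k : Fin d) → A k} (hc : DeltaC δ c ∈ interior (Yset δ T q)) :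
    AcceptsD T q c := by
  have lim : Tendsto (alternateFrom hA δ c) atTop (𝓝 c) :=
    tendsto_of_agree_below fun n i hi => by funext k; simp [alternateFrom, hi]
  refine (isClosed_setOf_acceptsD hT q).mem_of_tendsto lim ?_
  filter_upwards [((continuous_deltaC δ).continuousAt.tendsto.comp lim).eventually
    (isOpen_interior.mem_nhds hc)] with n hn
  obtain ⟨c', hc', h⟩ := interior_subset hn
  rw [eq_of_deltaC_alternateFrom_eq hA δ c c' n h]
  exact hc'

theorem exists_prefix_deltaC_mem (δ : (k : Fin d) → A k ≃ Fin (Fintype.card (A k)))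
    {U : Set (EuclideanSpace ℝ (Fin d))} (hU : IsOpen U) {c : ℕ → (k : Fin d) → A k}
    (hc : DeltaC δ c ∈ U) :
    ∃ x : List ((k : Fin d) → A k), ∀ y, DeltaC δ (prependSeq x y) ∈ U := by
  by_contra! h
  choose y hy using fun n : ℕ => h (List.ofFn fun i : Fin n => c i)
  have lim := tendsto_of_agree_below (c := c)
    (u := fun n => prependSeq (List.ofFn fun i : Fin n => c i) (y n))
    fun n i hi => by simp [prependSeq, hi]
  obtain ⟨n, hn⟩ := (((continuous_deltaC δ).continuousAt.tendsto.comp lim).eventually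
    (hU.mem_nhds hc)).exists
  exact hy n hn

end Topology

theorem interior_range_deltaC_prependSeq_nonempty (hA : ∀ k, 1 < Fintype.card (A k))
    (δ : (k : Fin d) → A k ≃ Fin (Fintype.card (A k))) (x : List ((k : Fin d) → A k)) :
    (interior (Set.range fun y => DeltaC δ (prependSeq x y))).Nonempty := by
  choose p hp using fun k => exists_deltaInf_prependSeq δ k x
  have hpos : ∀ k, (0 : ℝ) < (Fintype.card (A k) : ℝ) ^ x.length := fun k =>
    pow_pos (by exact_mod_cast zero_lt_one.trans (hA k)) _
  let U : Set (EuclideanSpace ℝ (Fin d)) :=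
    {v | ∀ k, (v k - p k) * (Fintype.card (A k) : ℝ) ^ x.length ∈ Set.Ioo (0 : ℝ) 1}
  have hU : IsOpen U := by
    simp only [U, Set.ofPred_forall]
    exact isOpen_iInter_of_finite fun k => isOpen_Ioo.preimage (by fun_prop)
  refine ⟨WithLp.toLp 2 fun k => p k + 2⁻¹ / (Fintype.card (A k) : ℝ) ^ x.length,
    interior_maximal ?_ hU ?_⟩
  · intro v hv
    choose a _ ha using fun k =>
      Real.ofDigits_SurjOn (hA k) (Set.Ioo_subset_Icc_self (hv k))
    refine ⟨fun i k => (δ k).symm (a k i), ?_⟩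
    ext k
    rw [deltaC_apply, hp, deltaInf_eq_ofDigits]
    simp only [Equiv.apply_symm_apply]
    rw [ha, mul_div_cancel_right₀ _ (hpos k).ne']
    ring
  · intro k
    have := (hpos k).ne'
    simp only [add_sub_cancel_left, div_mul_cancel₀ _ this]
    norm_num

end

/-- States `q` and `r` have a common universal prefix (a single finite word `x` that is
a universal prefix for both `q` and `r`) if and only if `Y_q ∩ Y_r` has nonempty
interior in `ℝ^d`. -/
theorem commonUniversalPrefix_iff_inter_nonempty_interior {d : ℕ} {Q : Type*}
    {A : Fin d → Type*} [∀ k, Fintype (A k)] (hA : ∀ k, 1 < Fintype.card (A k))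
    (δ : (k : Fin d) → A k ≃ Fin (Fintype.card (A k)))
    (T : Set (Q × Q × ((k : Fin d) → List (A k)))) (hT : T.Finite)
    (hne : ∀ t ∈ T, ∀ k : Fin d, t.2.2 k ≠ []) (q r : Q) :
    (∃ x : List ((k : Fin d) → A k),
        (∀ y : ℕ → (k : Fin d) → A k, AcceptsD T q (prependSeq x y)) ∧
        (∀ y : ℕ → (k : Fin d) → A k, AcceptsD T r (prependSeq x y))) ↔
      (interior (Yset δ T q ∩ Yset δ T r)).Nonempty := by
  constructor
  · rintro ⟨x, hq, hr⟩
    refine (interior_range_deltaC_prependSeq_nonempty hA δ x).mono (interior_mono ?_)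
    rintro _ ⟨y, rfl⟩
    exact ⟨⟨_, hq y, rfl⟩, ⟨_, hr y, rfl⟩⟩
  · rintro ⟨v, hv⟩
    let _ : ∀ k, TopologicalSpace (A k) := fun _ => ⊥
    have _ : ∀ k, DiscreteTopology (A k) := fun _ => ⟨rfl⟩
    obtain ⟨c, -, rfl⟩ := (interior_subset hv).1
    obtain ⟨x, hx⟩ := exists_prefix_deltaC_mem δ isOpen_interior hv
    exact ⟨x, fun y => acceptsD_of_deltaC_mem_interior hA δ hT
        (interior_mono Set.inter_subset_left (hx y)),
      fun y => acceptsD_of_deltaC_mem_interior hA δ hT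
        (interior_mono Set.inter_subset_right (hx y))⟩
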